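/- Let A be a Hermitian n×n matrix over the split quaternion algebra H with det A ≠ 0. Then A is invertible with a unique two-sided inverse A⁻¹, and A⁻¹ admits the determinantal representations A⁻¹ = (1/det A)·(R_{ji})_{i,j} (the (i,j) entry of A⁻¹ is R_{ji}/det A, where R_{pq} is the right pq-th cofactor of A) and A⁻¹ = (1/det A)·(L_{ji})_{i,j} (the (i,j) entry of A⁻¹ is L_{ji}/det A, where L_{pq} is the left pq-th cofactor of A); in particular these two matrices coincide and satisfy A·A⁻¹ = A⁻¹·A = I. -/

import Mathlib

/-- The split quaternion (coquaternion) algebra over ℝ: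
`i² = −1`, `j² = 1`, `k² = 1`, `ij = −ji = k`. -/
abbrev SplitQuaternion : Type := QuaternionAlgebra ℝ (-1) 0 1

noncomputable section

namespace SplitQuaternion

variable {n : ℕ}

/-- The ordered product of entries of `A` along the cycle of `σ` containing `s`,
read in the "row" direction:
`a_{s, σ s} * a_{σ s, σ² s} * ⋯ * a_{σ^{L−1} s, s}` where `L` is the cycle length. -/
def rowCycleProd (A : Matrix (Fin n) (Fin n) SplitQuaternion) (σ : Equiv.Perm (Fin n))
    (s : Fin n) : SplitQuaternion :=
  ((List.range (Function.minimalPeriod σ s)).map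
    (fun m => A ((σ ^ m) s) ((σ ^ (m + 1)) s))).prod

/-- The ordered product of entries of `A` along the cycle of `σ` containing `s`,
read in the "column" direction:
`a_{s, σ^{L−1} s} * ⋯ * a_{σ² s, σ s} * a_{σ s, s}` where `L` is the cycle length. -/
def colCycleProd (A : Matrix (Fin n) (Fin n) SplitQuaternion) (σ : Equiv.Perm (Fin n))
    (s : Fin n) : SplitQuaternion :=
  (((List.range (Function.minimalPeriod σ s)).map
    (fun m => A ((σ ^ (m + 1)) s) ((σ ^ m) s))).reverse).prod

open scoped Classical in
/-- The least elements of the cycles of `σ` other than the cycle containing `i`,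
listed in increasing order. -/
def otherCycleMins (σ : Equiv.Perm (Fin n)) (i : Fin n) : List (Fin n) :=
  (Finset.univ.filter (fun s : Fin n =>
    (∀ t, σ.SameCycle s t → s ≤ t) ∧ ¬ σ.SameCycle i s)).sort (· ≤ ·)

/-- The `i`-th row determinant of `A`: the sum over all permutations `σ` of
`(−1)^{n−r}` (which is `sign σ`, `r` being the number of disjoint cycles of `σ`,
fixed points included) times the product of the entries of `A` ordered according to
the left-ordered cycle notation of `σ` whose first cycle starts with `i`, every
other cycle starting with its least element, the cycles being ordered by
increasing least elements. -/
def rdet (A : Matrix (Fin n) (Fin n) SplitQuaternion) (i : Fin n) : SplitQuaternion :=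
  ∑ σ : Equiv.Perm (Fin n),
    ((Equiv.Perm.sign σ : ℤ) : SplitQuaternion) *
      (rowCycleProd A σ i * ((otherCycleMins σ i).map (rowCycleProd A σ)).prod)

/-- The `j`-th column determinant of `A`: the sum over all permutations `τ` of
`(−1)^{n−r}` times the product of the entries of `A` ordered according to the
right-ordered cycle notation of `τ` whose rightmost cycle ends with `j`, every
other cycle ending with its least element, the cycles being ordered (from right
to left) by increasing least elements. -/
def cdet (A : Matrix (Fin n) (Fin n) SplitQuaternion) (j : Fin n) : SplitQuaternion :=
  ∑ σ : Equiv.Perm (Fin n),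
    ((Equiv.Perm.sign σ : ℤ) : SplitQuaternion) *
      ((((otherCycleMins σ j).reverse).map (colCycleProd A σ)).prod * colCycleProd A σ j)

/-- The determinant of a Hermitian matrix: the common value of all row and column
determinants (here given as `rdet` at the index `0`). -/
def hdet [NeZero n] (A : Matrix (Fin n) (Fin n) SplitQuaternion) : SplitQuaternion :=
  rdet A 0


/-- The right `ij`-th cofactor of `A`: for `i ≠ j` it is `− rdet_k A^{ii}_{.j}(a_{.i})`,
where `A^{ii}_{.j}(a_{.i})` is obtained from `A` by replacing the `j`-th column with the
`i`-th column and deleting both the `i`-th row and column, and `k = j` if `i > j` while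
`k = j − 1` if `i < j`; for `i = j` it is `rdet_k A^{ii}` where `k` is the least
remaining index (i.e. position `0` of the submatrix). -/
def cofR (A : Matrix (Fin (n + 1)) (Fin (n + 1)) SplitQuaternion) (i j : Fin (n + 1)) :
    SplitQuaternion :=
  if hij : i = j then
    if hn : 0 < n then rdet (A.submatrix i.succAbove i.succAbove) ⟨0, hn⟩ else 1
  else
    - rdet ((A.updateCol j (fun p => A p i)).submatrix i.succAbove i.succAbove)
        ⟨if (j : ℕ) < (i : ℕ) then (j : ℕ) else (j : ℕ) - 1, by
          have h1 := i.isLt; have h2 := j.isLt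
          have h3 : (i : ℕ) ≠ (j : ℕ) := fun h => hij (Fin.ext h)
          split <;> omega⟩

/-- The left `ij`-th cofactor of `A`: for `i ≠ j` it is `− cdet_k A^{jj}_{i.}(a_{j.})`,
where `A^{jj}_{i.}(a_{j.})` is obtained from `A` by replacing the `i`-th row with the
`j`-th row and deleting both the `j`-th row and column, and `k = i` if `j > i` while
`k = i − 1` if `j < i`; for `i = j` it is `cdet_k A^{jj}` where `k` is the least
remaining index (i.e. position `0` of the submatrix). -/
def cofL (A : Matrix (Fin (n + 1)) (Fin (n + 1)) SplitQuaternion) (i j : Fin (n + 1)) :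
    SplitQuaternion :=
  if hij : i = j then
    if hn : 0 < n then cdet (A.submatrix j.succAbove j.succAbove) ⟨0, hn⟩ else 1
  else
    - cdet ((A.updateRow i (fun q => A j q)).submatrix j.succAbove j.succAbove)
        ⟨if (i : ℕ) < (j : ℕ) then (i : ℕ) else (i : ℕ) - 1, by
          have h1 := i.isLt; have h2 := j.isLt
          have h3 : (i : ℕ) ≠ (j : ℕ) := fun h => hij (Fin.ext h)
          split <;> omega⟩

section Orbits

variable {a b : ℕ}

lemma minimalPeriod_perm_pos (σ : Equiv.Perm (Fin a)) (s : Fin a) :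
    0 < Function.minimalPeriod σ s := by
  apply Function.minimalPeriod_pos_of_mem_periodicPts
  exact σ.injective.mem_periodicPts s

lemma pow_minimalPeriod_apply (σ : Equiv.Perm (Fin a)) (s : Fin a) :
    (σ ^ Function.minimalPeriod σ s) s = s := by
  rw [Equiv.Perm.coe_pow]
  exact Function.iterate_minimalPeriod

lemma pow_apply_ne_of_lt_minimalPeriod (σ : Equiv.Perm (Fin a)) (s : Fin a) {m : ℕ}
    (h0 : 0 < m) (h : m < Function.minimalPeriod σ s) : (σ ^ m) s ≠ s := by
  rw [Equiv.Perm.coe_pow]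
  exact Function.not_isPeriodicPt_of_pos_of_lt_minimalPeriod h0.ne' h

lemma sameCycle_iff_exists_lt (σ : Equiv.Perm (Fin a)) (s t : Fin a) :
    σ.SameCycle s t ↔ ∃ m < Function.minimalPeriod σ s, (σ ^ m) s = t := by
  constructor
  · intro h
    obtain ⟨m, rfl⟩ := h.exists_nat_pow_eq
    refine ⟨m % Function.minimalPeriod σ s, Nat.mod_lt _ (minimalPeriod_perm_pos σ s), ?_⟩
    rw [Equiv.Perm.coe_pow, Equiv.Perm.coe_pow]
    exact Function.iterate_mod_minimalPeriod_eq
  · rintro ⟨m, -, rfl⟩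
    exact ⟨m, by simp⟩

/-- A sequence that follows `σ` from `s` and first returns to `s` after `L` steps
enumerates the cycle of `s`. -/
lemma orbit_eq_of_path {σ : Equiv.Perm (Fin a)} {s : Fin a} {f : ℕ → Fin a} {L : ℕ}
    (hL : 0 < L) (h0 : f 0 = s) (hLs : f L = s) (hstep : ∀ m < L, σ (f m) = f (m + 1))
    (hne : ∀ m, 0 < m → m < L → f m ≠ s) :
    Function.minimalPeriod σ s = L ∧ ∀ m ≤ L, (σ ^ m) s = f m := by
  have hpow : ∀ m ≤ L, (σ ^ m) s = f m := by
    intro m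
    induction m with
    | zero => intro _; simp [h0]
    | succ m ih =>
      intro hm
      rw [pow_succ', Equiv.Perm.mul_apply, ih (by omega), hstep m (by omega)]
  refine ⟨le_antisymm ?_ ?_, hpow⟩
  · apply Function.IsPeriodicPt.minimalPeriod_le hL
    change σ^[L] s = s
    rw [← Equiv.Perm.coe_pow, hpow L le_rfl, hLs]
  · by_contra! hlt
    have h1 := pow_minimalPeriod_apply σ s
    rw [hpow _ hlt.le] at h1
    exact hne _ (minimalPeriod_perm_pos σ s) hlt h1

lemma rowCycleProd_eq_of_path (M : Matrix (Fin a) (Fin a) SplitQuaternion)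
    {σ : Equiv.Perm (Fin a)} {s : Fin a} {f : ℕ → Fin a} {L : ℕ}
    (hL : 0 < L) (h0 : f 0 = s) (hLs : f L = s) (hstep : ∀ m < L, σ (f m) = f (m + 1))
    (hne : ∀ m, 0 < m → m < L → f m ≠ s) :
    rowCycleProd M σ s = ((List.range L).map fun m => M (f m) (f (m + 1))).prod := by
  obtain ⟨h1, h2⟩ := orbit_eq_of_path hL h0 hLs hstep hne
  unfold rowCycleProd
  rw [h1]
  congr 1
  apply List.map_congr_left
  intro m hm
  rw [List.mem_range] at hm
  rw [h2 m hm.le, h2 (m + 1) hm]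

lemma sameCycle_iff_of_path {σ : Equiv.Perm (Fin a)} {s : Fin a} {f : ℕ → Fin a} {L : ℕ}
    (hL : 0 < L) (h0 : f 0 = s) (hLs : f L = s) (hstep : ∀ m < L, σ (f m) = f (m + 1))
    (hne : ∀ m, 0 < m → m < L → f m ≠ s) (t : Fin a) :
    σ.SameCycle s t ↔ ∃ m < L, f m = t := by
  obtain ⟨h1, h2⟩ := orbit_eq_of_path hL h0 hLs hstep hne
  rw [sameCycle_iff_exists_lt, h1]
  refine exists_congr fun m => and_congr_right fun hm => ?_
  rw [h2 m hm.le]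

section Transfer

variable {e : Fin a → Fin b} {σ : Equiv.Perm (Fin a)} {τ : Equiv.Perm (Fin b)} {s : Fin a}

lemma sameCycle_pow_self (σ : Equiv.Perm (Fin a)) (s : Fin a) (m : ℕ) :
    σ.SameCycle s ((σ ^ m) s) := ⟨m, by simp⟩

lemma sameCycle_iff_of_conj (he : Function.Injective e)
    (h : ∀ y, σ.SameCycle s y → τ (e y) = e (σ y)) (t : Fin b) :
    τ.SameCycle (e s) t ↔ ∃ y, σ.SameCycle s y ∧ e y = t := by
  rw [sameCycle_iff_of_path (f := fun m => e ((σ ^ m) s)) (minimalPeriod_perm_pos σ s)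
    (by simp) (by simp [pow_minimalPeriod_apply])
    (fun m _ => by rw [h _ (sameCycle_pow_self σ s m), pow_succ', Equiv.Perm.mul_apply])
    (fun m h0 h1 => he.ne (pow_apply_ne_of_lt_minimalPeriod σ s h0 h1))]
  simp only [sameCycle_iff_exists_lt]
  constructor
  · rintro ⟨m, hm, rfl⟩; exact ⟨_, ⟨m, hm, rfl⟩, rfl⟩
  · rintro ⟨_, ⟨m, hm, rfl⟩, rfl⟩; exact ⟨m, hm, rfl⟩

lemma rowCycleProd_eq_of_conj (he : Function.Injective e)
    (h : ∀ y, σ.SameCycle s y → τ (e y) = e (σ y))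
    {M : Matrix (Fin a) (Fin a) SplitQuaternion} {N : Matrix (Fin b) (Fin b) SplitQuaternion}
    (hM : ∀ y, σ.SameCycle s y → N (e y) (e (σ y)) = M y (σ y)) :
    rowCycleProd N τ (e s) = rowCycleProd M σ s := by
  rw [rowCycleProd_eq_of_path N (f := fun m => e ((σ ^ m) s)) (minimalPeriod_perm_pos σ s)
    (by simp) (by simp [pow_minimalPeriod_apply])
    (fun m _ => by rw [h _ (sameCycle_pow_self σ s m), pow_succ', Equiv.Perm.mul_apply])
    (fun m h0 h1 => he.ne (pow_apply_ne_of_lt_minimalPeriod σ s h0 h1))]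
  unfold rowCycleProd
  congr 1
  apply List.map_congr_left
  intro m _
  have := hM _ (sameCycle_pow_self σ s m)
  rw [pow_succ', Equiv.Perm.mul_apply, this]

end Transfer

lemma re_mul_comm (x y : SplitQuaternion) : (x * y).re = (y * x).re := by
  simp [QuaternionAlgebra.re_mul]; ring

lemma re_rowCycleProd_apply (M : Matrix (Fin a) (Fin a) SplitQuaternion)
    (σ : Equiv.Perm (Fin a)) (s : Fin a) :
    (rowCycleProd M σ (σ s)).re = (rowCycleProd M σ s).re := by
  have hper : Function.minimalPeriod σ (σ s) = Function.minimalPeriod σ s :=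
    Function.minimalPeriod_apply (σ.injective.mem_periodicPts s)
  obtain ⟨L, hL⟩ := Nat.exists_eq_succ_of_ne_zero (minimalPeriod_perm_pos σ s).ne'
  have hs := pow_minimalPeriod_apply σ s
  unfold rowCycleProd
  rw [hper, hL, List.prod_range_succ, List.prod_range_succ', re_mul_comm]
  rw [hL] at hs
  have hs' : ∀ m, (σ ^ m) (σ s) = (σ ^ (m + 1)) s := fun m => by
    rw [pow_succ, Equiv.Perm.mul_apply]
  simp only [hs']
  have : (σ ^ (L + 1 + 1)) s = (σ ^ (0 + 1)) s := by
    rw [pow_succ', Equiv.Perm.mul_apply, ← Nat.succ_eq_add_one, hs]; simp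
  rw [this, ← Nat.succ_eq_add_one L, hs]
  simp

lemma re_rowCycleProd_eq_of_sameCycle (M : Matrix (Fin a) (Fin a) SplitQuaternion)
    {σ : Equiv.Perm (Fin a)} {s t : Fin a} (h : σ.SameCycle s t) :
    (rowCycleProd M σ t).re = (rowCycleProd M σ s).re := by
  obtain ⟨m, rfl⟩ := h.exists_nat_pow_eq
  induction m with
  | zero => simp
  | succ m ih =>
    rw [pow_succ', Equiv.Perm.mul_apply, re_rowCycleProd_apply, ih (sameCycle_pow_self σ s m)]

end Orbits

section Reversal

variable {a : ℕ}

lemma inv_apply_apply (σ : Equiv.Perm (Fin a)) (x : Fin a) : σ⁻¹ (σ x) = x :=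
  σ.symm_apply_apply x

open scoped Classical in
/-- The permutation obtained from `σ` by reversing the cycle that contains `t`. -/
def reverseCycle (t : Fin a) (σ : Equiv.Perm (Fin a)) : Equiv.Perm (Fin a) :=
  (σ.cycleOf t)⁻¹ * (σ.cycleOf t)⁻¹ * σ

variable {t : Fin a} {σ : Equiv.Perm (Fin a)}

lemma sign_reverseCycle : Equiv.Perm.sign (reverseCycle t σ) = Equiv.Perm.sign σ := by
  simp [reverseCycle, Int.units_mul_self]

lemma reverseCycle_apply {x : Fin a} (h : σ.SameCycle t x) : reverseCycle t σ x = σ⁻¹ x := by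
  classical
  simp only [reverseCycle, Equiv.Perm.cycleOf_inv, Equiv.Perm.mul_apply]
  have h1 : σ⁻¹.SameCycle t (σ x) := by
    rwa [Equiv.Perm.sameCycle_inv, Equiv.Perm.sameCycle_apply_right]
  have h2 : σ⁻¹.SameCycle t x := by rwa [Equiv.Perm.sameCycle_inv]
  rw [h1.cycleOf_apply, inv_apply_apply, h2.cycleOf_apply]

lemma reverseCycle_apply_of_not_sameCycle {x : Fin a} (h : ¬ σ.SameCycle t x) :
    reverseCycle t σ x = σ x := by
  classical
  simp only [reverseCycle, Equiv.Perm.cycleOf_inv, Equiv.Perm.mul_apply]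
  have h1 : ¬ σ⁻¹.SameCycle t (σ x) := by
    rwa [Equiv.Perm.sameCycle_inv, Equiv.Perm.sameCycle_apply_right]
  rw [Equiv.Perm.cycleOf_apply_of_not_sameCycle h1, Equiv.Perm.cycleOf_apply_of_not_sameCycle h1]

lemma minimalPeriod_inv (σ : Equiv.Perm (Fin a)) (s : Fin a) :
    Function.minimalPeriod (σ⁻¹ : Equiv.Perm (Fin a)) s = Function.minimalPeriod σ s := by
  rw [Function.minimalPeriod_eq_minimalPeriod_iff]
  intro m
  change ((σ⁻¹ : Equiv.Perm (Fin a)) : Fin a → Fin a)^[m] s = s ↔ (σ : Fin a → Fin a)^[m] s = s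
  rw [← Equiv.Perm.coe_pow, ← Equiv.Perm.coe_pow, inv_pow, Equiv.Perm.inv_eq_iff_eq, eq_comm]

lemma sameCycle_reverseCycle (s u : Fin a) :
    (reverseCycle t σ).SameCycle s u ↔ σ.SameCycle s u := by
  by_cases hs : σ.SameCycle t s
  · rw [← Equiv.Perm.sameCycle_inv (f := σ)]
    have := sameCycle_iff_of_conj (e := id) (σ := σ⁻¹) (τ := reverseCycle t σ) (s := s)
      Function.injective_id
      (fun y hy => reverseCycle_apply (hs.trans (Equiv.Perm.sameCycle_inv.1 hy))) u
    simpa using this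
  · have := sameCycle_iff_of_conj (e := id) (σ := σ) (τ := reverseCycle t σ) (s := s)
      Function.injective_id
      (fun y hy => reverseCycle_apply_of_not_sameCycle fun h => hs (h.trans hy.symm)) u
    simpa using this

lemma reverseCycle_reverseCycle : reverseCycle t (reverseCycle t σ) = σ := by
  ext1 x
  by_cases h : σ.SameCycle t x
  · rw [reverseCycle_apply ((sameCycle_reverseCycle _ _).2 h), Equiv.Perm.inv_eq_iff_eq,
      reverseCycle_apply (Equiv.Perm.sameCycle_apply_right.2 h), inv_apply_apply]
  · rw [reverseCycle_apply_of_not_sameCycle (fun h' => h ((sameCycle_reverseCycle _ _).1 h')),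
      reverseCycle_apply_of_not_sameCycle h]

lemma rowCycleProd_reverseCycle_of_not_sameCycle (M : Matrix (Fin a) (Fin a) SplitQuaternion)
    {s : Fin a} (h : ¬ σ.SameCycle t s) :
    rowCycleProd M (reverseCycle t σ) s = rowCycleProd M σ s :=
  rowCycleProd_eq_of_conj (e := id) Function.injective_id
    (fun _ hy => reverseCycle_apply_of_not_sameCycle fun h' => h (h'.trans hy.symm))
    (fun _ _ => rfl)

lemma star_list_prod (l : List SplitQuaternion) :
    star l.prod = (l.reverse.map star).prod := by
  induction l with
  | nil => simp
  | cons x l ih => simp [ih]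

lemma range_map_reverse {α : Type*} (f : ℕ → α) (L : ℕ) :
    ((List.range L).map f).reverse = (List.range L).map fun m => f (L - 1 - m) := by
  apply List.ext_getElem
  · simp
  · intro m h1 h2
    simp

lemma rowCycleProd_inv (M : Matrix (Fin a) (Fin a) SplitQuaternion) (σ : Equiv.Perm (Fin a))
    (s : Fin a) : rowCycleProd M σ⁻¹ s = colCycleProd M σ s := by
  unfold rowCycleProd colCycleProd
  rw [minimalPeriod_inv, range_map_reverse]
  congr 1
  apply List.map_congr_left
  intro m hm
  rw [List.mem_range] at hm
  have key : ∀ r ≤ Function.minimalPeriod σ s,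
      (σ⁻¹ ^ r) s = (σ ^ (Function.minimalPeriod σ s - r)) s := by
    intro r hr
    rw [inv_pow, Equiv.Perm.inv_eq_iff_eq, ← Equiv.Perm.mul_apply, ← pow_add,
      Nat.add_sub_cancel' hr, pow_minimalPeriod_apply]
  rw [key m hm.le, key (m + 1) hm]
  congr 3 <;> omega

lemma star_rowCycleProd (M : Matrix (Fin a) (Fin a) SplitQuaternion) (σ : Equiv.Perm (Fin a))
    (s : Fin a) : star (rowCycleProd M σ s) = colCycleProd M.conjTranspose σ s := by
  unfold rowCycleProd colCycleProd
  rw [star_list_prod, ← List.map_reverse, ← List.map_reverse, List.map_map]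
  rfl

lemma rowCycleProd_reverseCycle_eq_star {M : Matrix (Fin a) (Fin a) SplitQuaternion} {s : Fin a}
    (h : σ.SameCycle t s)
    (hM : ∀ x y, σ.SameCycle t x → σ.SameCycle t y → M x y = star (M y x)) :
    rowCycleProd M (reverseCycle t σ) s = star (rowCycleProd M σ s) := by
  rw [star_rowCycleProd, ← rowCycleProd_inv]
  refine rowCycleProd_eq_of_conj (e := id) Function.injective_id
    (fun y hy => reverseCycle_apply (h.trans (Equiv.Perm.sameCycle_inv.1 hy))) fun y hy => ?_
  have hy' : σ.SameCycle t y := h.trans (Equiv.Perm.sameCycle_inv.1 hy)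
  exact hM _ _ hy' (hy'.trans (Equiv.Perm.sameCycle_inv.1 ⟨1, by simp⟩))

end Reversal

section Averaging

variable {a : ℕ}

/-- The least elements of the cycles of `σ` other than the cycle containing `i`, as a finset. -/
def otherMins (σ : Equiv.Perm (Fin a)) (i : Fin a) : Finset (Fin a) :=
  (otherCycleMins σ i).toFinset

open scoped Classical in
/-- The least elements of all cycles of `σ`. -/
def cycleMins (σ : Equiv.Perm (Fin a)) : Finset (Fin a) :=
  Finset.univ.filter fun s => ∀ t, σ.SameCycle s t → s ≤ t

lemma mem_otherCycleMins {σ : Equiv.Perm (Fin a)} {i s : Fin a} :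
    s ∈ otherCycleMins σ i ↔ (∀ t, σ.SameCycle s t → s ≤ t) ∧ ¬ σ.SameCycle i s := by
  simp [otherCycleMins]

lemma mem_otherMins {σ : Equiv.Perm (Fin a)} {i s : Fin a} :
    s ∈ otherMins σ i ↔ (∀ t, σ.SameCycle s t → s ≤ t) ∧ ¬ σ.SameCycle i s := by
  rw [otherMins, List.mem_toFinset, mem_otherCycleMins]

lemma mem_cycleMins {σ : Equiv.Perm (Fin a)} {s : Fin a} :
    s ∈ cycleMins σ ↔ ∀ t, σ.SameCycle s t → s ≤ t := by
  simp [cycleMins]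

lemma nodup_otherCycleMins (σ : Equiv.Perm (Fin a)) (i : Fin a) : (otherCycleMins σ i).Nodup :=
  Finset.sort_nodup _ _

lemma otherCycleMins_reverseCycle (t : Fin a) (σ : Equiv.Perm (Fin a)) (i : Fin a) :
    otherCycleMins (reverseCycle t σ) i = otherCycleMins σ i := by
  unfold otherCycleMins
  congr 1
  ext s
  simp [sameCycle_reverseCycle]

lemma otherMins_reverseCycle (t : Fin a) (σ : Equiv.Perm (Fin a)) (i : Fin a) :
    otherMins (reverseCycle t σ) i = otherMins σ i := by
  rw [otherMins, otherCycleMins_reverseCycle, otherMins]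

lemma eq_of_sameCycle_of_min {σ : Equiv.Perm (Fin a)} {s t : Fin a}
    (hs : ∀ u, σ.SameCycle s u → s ≤ u) (ht : ∀ u, σ.SameCycle t u → t ≤ u)
    (h : σ.SameCycle s t) : s = t :=
  le_antisymm (hs t h) (ht s h.symm)

lemma exists_min_sameCycle (σ : Equiv.Perm (Fin a)) (i : Fin a) :
    ∃ m, σ.SameCycle i m ∧ ∀ t, σ.SameCycle m t → m ≤ t := by
  classical
  obtain ⟨m, hm, hmin⟩ := (Finset.univ.filter fun s => σ.SameCycle i s).exists_min_image id
    ⟨i, by simp [Equiv.Perm.SameCycle.rfl]⟩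
  simp only [Finset.mem_filter, Finset.mem_univ, true_and, id] at hm hmin
  exact ⟨m, hm, fun t ht => hmin t (hm.trans ht)⟩

lemma sum_eq_sum_of_involutive {E : Type*} [AddCommGroup E] [Module ℝ E]
    {ι : Type*} [Fintype ι] {φ : ι → ι} (hφ : Function.Involutive φ) {F G : ι → E}
    (h : ∀ x, F x + F (φ x) = (2 : ℝ) • G x) : ∑ x, F x = ∑ x, G x := by
  have h1 : ∑ x, F (φ x) = ∑ x, F x := Equiv.sum_comp hφ.toPerm F
  have h2 : (2 : ℝ) • ∑ x, F x = (2 : ℝ) • ∑ x, G x := by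
    rw [Finset.smul_sum (s := Finset.univ) (f := G), ← Finset.sum_congr rfl fun x _ => h x,
      Finset.sum_add_distrib, h1, two_smul]
  exact smul_right_injective E (two_ne_zero (α := ℝ)) h2

lemma add_star_eq (x : SplitQuaternion) : x + star x = (2 : ℝ) • (x.re : SplitQuaternion) := by
  ext <;> simp; ring

/-- If `M` is Hermitian away from `i`, every cycle product in `rdet M i` except the one through
`i` may be replaced by its real part. -/
lemma rdet_eq_sum_re {M : Matrix (Fin a) (Fin a) SplitQuaternion} {i : Fin a}
    (hM : ∀ p q, p ≠ i → q ≠ i → M p q = star (M q p)) :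
    rdet M i = ∑ σ : Equiv.Perm (Fin a),
      (((Equiv.Perm.sign σ : ℤ) : ℝ) * ∏ s ∈ otherMins σ i, (rowCycleProd M σ s).re) •
        rowCycleProd M σ i := by
  classical
  let g : Finset (Fin a) → Equiv.Perm (Fin a) → Fin a → SplitQuaternion := fun T σ s =>
    if s ∈ T then ((rowCycleProd M σ s).re : SplitQuaternion) else rowCycleProd M σ s
  let F : Finset (Fin a) → Equiv.Perm (Fin a) → SplitQuaternion := fun T σ =>
    ((Equiv.Perm.sign σ : ℤ) : SplitQuaternion) *
      (rowCycleProd M σ i * ((otherCycleMins σ i).map (g T σ)).prod)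
  have key : ∀ T, rdet M i = ∑ σ, F T σ := by
    intro T
    induction T using Finset.induction_on with
    | empty => simp [rdet, F, g]
    | insert t T ht ih =>
      rw [ih]
      let φ : Equiv.Perm (Fin a) → Equiv.Perm (Fin a) := fun σ =>
        if t ∈ otherCycleMins σ i then reverseCycle t σ else σ
      have hφ : Function.Involutive φ := by
        intro σ
        by_cases h : t ∈ otherCycleMins σ i
        · simp [φ, h, otherCycleMins_reverseCycle, reverseCycle_reverseCycle]
        · simp [φ, h]
      refine sum_eq_sum_of_involutive hφ fun σ => ?_
      by_cases h : t ∈ otherCycleMins σ i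
      · have hti := mem_otherCycleMins.1 h
        have hne : ∀ s ∈ otherCycleMins σ i, s ≠ t →
            rowCycleProd M (reverseCycle t σ) s = rowCycleProd M σ s := fun s hs hst =>
          rowCycleProd_reverseCycle_of_not_sameCycle M fun h' =>
            hst (eq_of_sameCycle_of_min hti.1 (mem_otherCycleMins.1 hs).1 h').symm
        have hi : rowCycleProd M (reverseCycle t σ) i = rowCycleProd M σ i :=
          rowCycleProd_reverseCycle_of_not_sameCycle M fun h' => hti.2 h'.symm
        have ht' : rowCycleProd M (reverseCycle t σ) t = star (rowCycleProd M σ t) := by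
          refine rowCycleProd_reverseCycle_eq_star Equiv.Perm.SameCycle.rfl fun x y hx hy =>
            hM x y ?_ ?_
          · rintro rfl; exact hti.2 hx.symm
          · rintro rfl; exact hti.2 hy.symm
        have hnd := nodup_otherCycleMins σ i
        simp only [F, φ, if_pos h, otherCycleMins_reverseCycle, sign_reverseCycle, hi]
        obtain ⟨l₁, l₂, hl⟩ := List.append_of_mem h
        rw [hl] at hnd hne ⊢
        have hn : t ∉ l₁ ∧ t ∉ l₂ := by
          rw [List.nodup_append, List.nodup_cons] at hnd
          refine ⟨fun h' => hnd.2.2 t h' t (by simp) rfl, hnd.2.1.1⟩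
        have e1 : ∀ l : List (Fin a), t ∉ l → (∀ s ∈ l, s ∈ l₁ ++ t :: l₂) →
            l.map (g T (reverseCycle t σ)) = l.map (g T σ) := by
          intro l hl hl'
          apply List.map_congr_left
          intro s hs
          simp only [g, hne s (hl' s hs) (fun h' => hl (h' ▸ hs))]
        have e2 : ∀ l : List (Fin a), t ∉ l →
            l.map (g (insert t T) σ) = l.map (g T σ) := by
          intro l hl
          apply List.map_congr_left
          intro s hs
          have : s ≠ t := fun h' => hl (h' ▸ hs)
          simp only [g, Finset.mem_insert, this, false_or]
        simp only [List.map_append, List.map_cons, List.prod_append, List.prod_cons]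
        rw [e1 l₁ hn.1 (by simp +contextual), e1 l₂ hn.2 (by simp +contextual),
          e2 l₁ hn.1, e2 l₂ hn.2]
        have g1 : g T σ t = rowCycleProd M σ t := by simp [g, ht]
        have g2 : g T (reverseCycle t σ) t = star (rowCycleProd M σ t) := by simp [g, ht, ht']
        have g3 : g (insert t T) σ t = ((rowCycleProd M σ t).re : SplitQuaternion) := by simp [g]
        rw [g1, g2, g3, ← mul_add, ← mul_add, ← mul_add, ← add_mul, add_star_eq]
        simp only [mul_smul_comm, smul_mul_assoc]
      · have hF : F (insert t T) σ = F T σ := by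
          simp only [F]
          congr 3
          apply List.map_congr_left
          intro s hs
          have : s ≠ t := by rintro rfl; exact h hs
          simp only [g, Finset.mem_insert, this, false_or]
        simp only [φ, if_neg h, hF, two_smul]
  rw [key Finset.univ]
  refine Finset.sum_congr rfl fun σ _ => ?_
  have h1 : ((otherCycleMins σ i).map (g Finset.univ σ)).prod =
      ((∏ s ∈ otherMins σ i, (rowCycleProd M σ s).re : ℝ) : SplitQuaternion) := by
    rw [otherMins, List.prod_toFinset _ (nodup_otherCycleMins σ i)]
    induction otherCycleMins σ i with
    | nil => simp
    | cons x l ih =>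
      rw [List.map_cons, List.prod_cons, ih]
      simp [g]
  simp only [F]
  rw [h1, QuaternionAlgebra.mul_coe_eq_smul, mul_smul, ← QuaternionAlgebra.coe_mul_eq_smul,
    Int.cast_smul_eq_zsmul, zsmul_eq_mul]

/-- The signed sum over permutations of the products of the real parts of the cycle products;
for a Hermitian matrix it is the common value of all row determinants. -/
def realDet (A : Matrix (Fin a) (Fin a) SplitQuaternion) : ℝ :=
  ∑ σ : Equiv.Perm (Fin a),
    ((Equiv.Perm.sign σ : ℤ) : ℝ) * ∏ s ∈ cycleMins σ, (rowCycleProd A σ s).re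

lemma prod_cycleMins (A : Matrix (Fin a) (Fin a) SplitQuaternion) (σ : Equiv.Perm (Fin a))
    (i : Fin a) :
    ∏ s ∈ cycleMins σ, (rowCycleProd A σ s).re =
      (∏ s ∈ otherMins σ i, (rowCycleProd A σ s).re) * (rowCycleProd A σ i).re := by
  classical
  obtain ⟨m, hm, hmin⟩ := exists_min_sameCycle σ i
  have h : cycleMins σ = insert m (otherMins σ i) := by
    ext s
    rw [Finset.mem_insert, mem_cycleMins, mem_otherMins]
    constructor
    · intro hs
      by_cases his : σ.SameCycle i s
      · exact Or.inl (eq_of_sameCycle_of_min hs hmin (his.symm.trans hm))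
      · exact Or.inr ⟨hs, his⟩
    · rintro (rfl | hs)
      · exact hmin
      · exact hs.1
  rw [h, Finset.prod_insert (fun h' => (mem_otherMins.1 h').2 hm), mul_comm,
    re_rowCycleProd_eq_of_sameCycle A hm]

lemma rdet_eq_realDet {A : Matrix (Fin a) (Fin a) SplitQuaternion} (hA : A.IsHermitian)
    (i : Fin a) : rdet A i = (realDet A : SplitQuaternion) := by
  have hA' : ∀ p q, A p q = star (A q p) := fun p q => (hA.apply p q).symm
  rw [rdet_eq_sum_re fun p q _ _ => hA' p q, realDet]
  have : ((∑ σ : Equiv.Perm (Fin a),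
      ((Equiv.Perm.sign σ : ℤ) : ℝ) * ∏ s ∈ cycleMins σ, (rowCycleProd A σ s).re : ℝ) :
        SplitQuaternion) = ∑ σ : Equiv.Perm (Fin a),
      (((Equiv.Perm.sign σ : ℤ) : ℝ) * ∏ s ∈ otherMins σ i, (rowCycleProd A σ s).re) •
        ((rowCycleProd A σ i).re : SplitQuaternion) := by
    rw [← QuaternionAlgebra.coe_algebraMap, map_sum]
    refine Finset.sum_congr rfl fun σ _ => ?_
    rw [prod_cycleMins A σ i, ← mul_assoc, QuaternionAlgebra.coe_algebraMap,
      QuaternionAlgebra.smul_coe]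
  rw [this]
  refine sum_eq_sum_of_involutive (φ := reverseCycle i)
    (fun σ => reverseCycle_reverseCycle) fun σ => ?_
  have h1 : rowCycleProd A (reverseCycle i σ) i = star (rowCycleProd A σ i) :=
    rowCycleProd_reverseCycle_eq_star Equiv.Perm.SameCycle.rfl fun x y _ _ => hA' x y
  have h2 : ∏ s ∈ otherMins σ i, (rowCycleProd A (reverseCycle i σ) s).re =
      ∏ s ∈ otherMins σ i, (rowCycleProd A σ s).re :=
    Finset.prod_congr rfl fun s hs => by
      rw [rowCycleProd_reverseCycle_of_not_sameCycle A (mem_otherMins.1 hs).2]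
  rw [otherMins_reverseCycle, sign_reverseCycle, h1, h2, ← smul_add, add_star_eq, smul_comm]

end Averaging

section Swap

variable {a : ℕ} {σ : Equiv.Perm (Fin a)} {i k : Fin a}

lemma exists_merged_path (h : ¬ σ.SameCycle i k) :
    ∃ f : ℕ → Fin a, f 0 = i ∧
      (∀ m, 0 < m → m ≤ Function.minimalPeriod σ k → f m = (σ ^ m) k) ∧
      (∀ m, 0 < m → f (Function.minimalPeriod σ k + m) = (σ ^ m) i) ∧
      (∀ m < Function.minimalPeriod σ k + Function.minimalPeriod σ i,
        (σ * Equiv.swap i k) (f m) = f (m + 1)) ∧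
      (∀ m, 0 < m → m < Function.minimalPeriod σ k + Function.minimalPeriod σ i → f m ≠ i) := by
  set p := Function.minimalPeriod σ k
  set q := Function.minimalPeriod σ i
  have hp : 0 < p := minimalPeriod_perm_pos σ k
  have hq : 0 < q := minimalPeriod_perm_pos σ i
  have hki : ∀ m, (σ ^ m) k ≠ i := fun m hm => h (hm ▸ (sameCycle_pow_self σ k m).symm)
  have hik : ∀ m, (σ ^ m) i ≠ k := fun m hm => h (hm ▸ sameCycle_pow_self σ i m)
  let f : ℕ → Fin a := fun m =>
    if m = 0 then i else if m ≤ p then (σ ^ m) k else (σ ^ (m - p)) i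
  have f1 : ∀ m, 0 < m → m ≤ p → f m = (σ ^ m) k := fun m h0 h1 => by
    simp [f, h0.ne', h1]
  have f2 : ∀ m, 0 < m → f (p + m) = (σ ^ m) i := fun m h0 => by
    have : ¬ p + m ≤ p := by omega
    simp [f, h0.ne']
  refine ⟨f, rfl, f1, f2, ?_, ?_⟩
  · intro m hm
    rcases Nat.eq_zero_or_pos m with rfl | h0
    · rw [f1 1 one_pos hp]
      simp [f]
    rcases lt_trichotomy m p with hlt | rfl | hgt
    · rw [f1 m h0 hlt.le, f1 (m + 1) (by omega) hlt, Equiv.Perm.mul_apply,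
        Equiv.swap_apply_of_ne_of_ne (hki m) (pow_apply_ne_of_lt_minimalPeriod σ k h0 hlt),
        pow_succ', Equiv.Perm.mul_apply]
    · rw [f1 p h0 le_rfl, f2 1 one_pos, pow_minimalPeriod_apply]
      simp
    · obtain ⟨r, rfl⟩ := Nat.exists_eq_add_of_lt hgt
      rw [add_assoc] at hm ⊢
      rw [add_assoc, f2 (r + 1) (by omega), f2 (r + 1 + 1) (by omega), Equiv.Perm.mul_apply,
        Equiv.swap_apply_of_ne_of_ne
          (pow_apply_ne_of_lt_minimalPeriod σ i (by omega) (by omega)) (hik _),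
        pow_succ' σ (r + 1), Equiv.Perm.mul_apply]
  · intro m h0 hm
    rcases le_or_gt m p with hle | hgt
    · rw [f1 m h0 hle]
      exact hki m
    · obtain ⟨r, rfl⟩ := Nat.exists_eq_add_of_lt hgt
      rw [add_assoc] at hm ⊢
      rw [f2 (r + 1) (by omega)]
      exact pow_apply_ne_of_lt_minimalPeriod σ i (by omega) (by omega)

lemma rowCycleProd_mul_swap {M : Matrix (Fin a) (Fin a) SplitQuaternion} (hM : M i = M k)
    (h : ¬ σ.SameCycle i k) :
    rowCycleProd M (σ * Equiv.swap i k) i = rowCycleProd M σ k * rowCycleProd M σ i := by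
  obtain ⟨f, f0, f1, f2, hstep, hne⟩ := exists_merged_path h
  have hp := minimalPeriod_perm_pos σ k
  have hq := minimalPeriod_perm_pos σ i
  rw [rowCycleProd_eq_of_path M (by omega) f0
    (by rw [f2 _ hq, pow_minimalPeriod_apply]) hstep hne, List.range_add, List.map_append,
    List.prod_append, List.map_map]
  unfold rowCycleProd
  congr 2
  · apply List.map_congr_left
    intro m hm
    rw [List.mem_range] at hm
    rw [f1 (m + 1) (by omega) hm]
    rcases Nat.eq_zero_or_pos m with rfl | h0
    · rw [f0, hM]; simp
    · rw [f1 m h0 hm.le]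
  · apply List.map_congr_left
    intro m hm
    simp only [Function.comp_apply]
    rw [add_assoc, f2 (m + 1) (by omega)]
    rcases Nat.eq_zero_or_pos m with rfl | h0
    · rw [add_zero, f1 _ hp le_rfl, pow_minimalPeriod_apply, ← hM]; simp
    · rw [f2 m h0]

lemma sameCycle_mul_swap_iff (h : ¬ σ.SameCycle i k) (t : Fin a) :
    (σ * Equiv.swap i k).SameCycle i t ↔ σ.SameCycle i t ∨ σ.SameCycle k t := by
  obtain ⟨f, f0, f1, f2, hstep, hne⟩ := exists_merged_path h
  have hp := minimalPeriod_perm_pos σ k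
  have hq := minimalPeriod_perm_pos σ i
  rw [sameCycle_iff_of_path (by omega) f0
    (by rw [f2 _ hq, pow_minimalPeriod_apply]) hstep hne]
  constructor
  · rintro ⟨m, hm, rfl⟩
    rcases Nat.eq_zero_or_pos m with rfl | h0
    · rw [f0]; exact Or.inl Equiv.Perm.SameCycle.rfl
    rcases le_or_gt m (Function.minimalPeriod σ k) with hle | hgt
    · rw [f1 m h0 hle]; exact Or.inr (sameCycle_pow_self σ k m)
    · obtain ⟨r, rfl⟩ := Nat.exists_eq_add_of_lt hgt
      rw [add_assoc, f2 (r + 1) (by omega)]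
      exact Or.inl (sameCycle_pow_self σ i _)
  · rintro (h' | h') <;> rw [sameCycle_iff_exists_lt] at h' <;> obtain ⟨m, hm, rfl⟩ := h' <;>
      rcases Nat.eq_zero_or_pos m with rfl | h0
    · exact ⟨0, by omega, by simp [f0]⟩
    · exact ⟨_, by omega, f2 m h0⟩
    · exact ⟨Function.minimalPeriod σ k, by omega, by
        rw [f1 _ hp le_rfl, pow_minimalPeriod_apply]; simp⟩
    · exact ⟨m, by omega, f1 m h0 hm.le⟩

lemma not_sameCycle_mul_swap (hik : i ≠ k) (h : σ.SameCycle i k) :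
    ¬ (σ * Equiv.swap i k).SameCycle i k := by
  classical
  have hex := h.exists_nat_pow_eq
  set d := Nat.find hex
  have hd : (σ ^ d) i = k := Nat.find_spec hex
  have hmin : ∀ m < d, (σ ^ m) i ≠ k := fun m hm => Nat.find_min hex hm
  have hd0 : 0 < d := by
    rcases Nat.eq_zero_or_pos d with h0 | h0
    · rw [h0] at hd; exact absurd (by simpa using hd) hik
    · exact h0
  have hi : ∀ m, 0 < m → m < d → (σ ^ m) i ≠ i := by
    intro m h0 hm hmi
    apply hmin (d - m) (by omega)
    rw [← hd]
    conv_rhs => rw [← Nat.sub_add_cancel hm.le, pow_add, Equiv.Perm.mul_apply, hmi]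
  intro hs
  let f : ℕ → Fin a := fun m => if m = 0 then k else (σ ^ m) i
  have f1 : ∀ m, 0 < m → f m = (σ ^ m) i := fun m h0 => by simp [f, h0.ne']
  have := (sameCycle_iff_of_path (σ := σ * Equiv.swap i k) (f := f) hd0 rfl
    ((f1 d hd0).trans hd) (by
      intro m hm
      rcases Nat.eq_zero_or_pos m with rfl | h0
      · rw [f1 1 one_pos, Equiv.Perm.mul_apply, show f 0 = k from rfl]; simp
      · rw [f1 m h0, f1 (m + 1) (by omega), Equiv.Perm.mul_apply,
          Equiv.swap_apply_of_ne_of_ne (hi m h0 hm) (hmin m hm), pow_succ', Equiv.Perm.mul_apply])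
    (fun m h0 hm => by rw [f1 m h0]; exact hmin m hm) i).1 hs.symm
  obtain ⟨m, hm, hmi⟩ := this
  rcases Nat.eq_zero_or_pos m with rfl | h0
  · exact hik hmi.symm
  · rw [f1 m h0] at hmi
    exact hi m h0 hm hmi

lemma mul_swap_apply_of_not_sameCycle {s : Fin a} (hi : ¬ σ.SameCycle i s)
    (hk : ¬ σ.SameCycle k s) (y : Fin a) (hy : σ.SameCycle s y) :
    (σ * Equiv.swap i k) y = σ y := by
  rw [Equiv.Perm.mul_apply, Equiv.swap_apply_of_ne_of_ne]
  · rintro rfl; exact hi hy.symm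
  · rintro rfl; exact hk hy.symm

open scoped Classical in
lemma otherMins_mul_swap (h : ¬ σ.SameCycle i k) :
    otherMins (σ * Equiv.swap i k) i = (otherMins σ i).filter fun s => ¬ σ.SameCycle k s := by
  ext s
  rw [Finset.mem_filter, mem_otherMins, mem_otherMins, sameCycle_mul_swap_iff h, not_or]
  by_cases hi : σ.SameCycle i s
  · simp [hi]
  by_cases hk : σ.SameCycle k s
  · simp [hk]
  have := sameCycle_iff_of_conj (e := id) (σ := σ) (τ := σ * Equiv.swap i k) (s := s)
    Function.injective_id (mul_swap_apply_of_not_sameCycle hi hk)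
  simp only [id, exists_eq_right] at this
  simp [hi, hk, this]

/-- A row determinant vanishes when the row at which it is taken repeats another row. -/
lemma rdet_eq_zero_of_row_eq {M : Matrix (Fin a) (Fin a) SplitQuaternion} (hik : i ≠ k)
    (hM : ∀ p q, p ≠ i → q ≠ i → M p q = star (M q p)) (hrow : M i = M k) : rdet M i = 0 := by
  classical
  rw [rdet_eq_sum_re hM]
  set W : Equiv.Perm (Fin a) → SplitQuaternion := fun σ =>
    (((Equiv.Perm.sign σ : ℤ) : ℝ) * ∏ s ∈ otherMins σ i, (rowCycleProd M σ s).re) •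
      rowCycleProd M σ i with hW
  let P : Equiv.Perm (Fin a) → ℝ := fun σ =>
    ∏ s ∈ (otherMins σ i).filter (fun s => ¬ σ.SameCycle k s), (rowCycleProd M σ s).re
  have hW1 : ∀ σ : Equiv.Perm (Fin a), ¬ σ.SameCycle i k →
      W σ = (((Equiv.Perm.sign σ : ℤ) : ℝ) * ((rowCycleProd M σ k).re * P σ)) •
        rowCycleProd M σ i := by
    intro σ h
    obtain ⟨m, hm, hmin⟩ := exists_min_sameCycle σ k
    have : otherMins σ i =
        insert m ((otherMins σ i).filter fun s => ¬ σ.SameCycle k s) := by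
      ext s
      rw [Finset.mem_insert, Finset.mem_filter, mem_otherMins]
      constructor
      · intro hs
        by_cases hks : σ.SameCycle k s
        · exact Or.inl (eq_of_sameCycle_of_min hs.1 hmin (hks.symm.trans hm))
        · exact Or.inr ⟨hs, hks⟩
      · rintro (rfl | hs)
        · exact ⟨hmin, fun h' => h (h'.trans hm.symm)⟩
        · exact hs.1
    simp only [hW]
    have hnot : m ∉ (otherMins σ i).filter fun s => ¬ σ.SameCycle k s := fun h' =>
      (Finset.mem_filter.1 h').2 hm
    rw [this, Finset.prod_insert hnot,
      re_rowCycleProd_eq_of_sameCycle M hm]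
  have hW2 : ∀ σ : Equiv.Perm (Fin a), ¬ σ.SameCycle i k →
      W (σ * Equiv.swap i k) = -((((Equiv.Perm.sign σ : ℤ) : ℝ) * P σ) •
        (rowCycleProd M σ k * rowCycleProd M σ i)) := by
    intro σ h
    have hP : ∏ s ∈ otherMins (σ * Equiv.swap i k) i,
        (rowCycleProd M (σ * Equiv.swap i k) s).re = P σ := by
      rw [otherMins_mul_swap h]
      refine Finset.prod_congr rfl fun s hs => ?_
      rw [Finset.mem_filter, mem_otherMins] at hs
      exact congrArg _ (rowCycleProd_eq_of_conj (e := id) Function.injective_id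
        (mul_swap_apply_of_not_sameCycle hs.1.2 hs.2) fun _ _ => rfl)
    simp only [hW]
    rw [hP, rowCycleProd_mul_swap hrow h, Equiv.Perm.sign_mul, Equiv.Perm.sign_swap hik]
    simp
  let H : Equiv.Perm (Fin a) → SplitQuaternion := fun σ =>
    if σ.SameCycle i k then 0 else W σ + W (σ * Equiv.swap i k)
  have hsum : ∑ σ, W σ = ∑ σ, H σ := by
    have h1 : ∀ σ, H σ = (if σ.SameCycle i k then 0 else W σ) +
        (if (σ * Equiv.swap i k).SameCycle i k then W (σ * Equiv.swap i k) else 0) := by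
      intro σ
      by_cases h : σ.SameCycle i k
      · simp [H, h, not_sameCycle_mul_swap hik h]
      · have : (σ * Equiv.swap i k).SameCycle i k :=
          (sameCycle_mul_swap_iff h k).2 (Or.inr Equiv.Perm.SameCycle.rfl)
        simp [H, h, this]
    have h2 : ∑ σ : Equiv.Perm (Fin a),
        (if (σ * Equiv.swap i k).SameCycle i k then W (σ * Equiv.swap i k) else 0) =
          ∑ σ : Equiv.Perm (Fin a), if σ.SameCycle i k then W σ else 0 :=
      Equiv.sum_comp (Equiv.mulRight (Equiv.swap i k))
        fun σ : Equiv.Perm (Fin a) => if σ.SameCycle i k then W σ else 0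
    rw [Finset.sum_congr rfl fun σ _ => h1 σ, Finset.sum_add_distrib, h2,
      ← Finset.sum_add_distrib]
    refine Finset.sum_congr rfl fun σ _ => ?_
    split_ifs <;> simp
  rw [hsum]
  refine (sum_eq_sum_of_involutive (φ := reverseCycle k) (G := fun _ => 0)
    (fun σ => reverseCycle_reverseCycle) fun σ => ?_).trans Finset.sum_const_zero
  by_cases h : σ.SameCycle i k
  · simp [H, h, sameCycle_reverseCycle]
  have h' : ¬ (reverseCycle k σ).SameCycle i k := by rwa [sameCycle_reverseCycle]
  have hx : rowCycleProd M (reverseCycle k σ) k = star (rowCycleProd M σ k) := by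
    refine rowCycleProd_reverseCycle_eq_star Equiv.Perm.SameCycle.rfl fun x y hx hy =>
      hM x y ?_ ?_
    · rintro rfl; exact h hx.symm
    · rintro rfl; exact h hy.symm
  have hy : rowCycleProd M (reverseCycle k σ) i = rowCycleProd M σ i :=
    rowCycleProd_reverseCycle_of_not_sameCycle M fun h' => h h'.symm
  have hP : P (reverseCycle k σ) = P σ := by
    simp only [P]
    rw [otherMins_reverseCycle]
    simp only [sameCycle_reverseCycle]
    refine Finset.prod_congr rfl fun s hs => ?_
    rw [rowCycleProd_reverseCycle_of_not_sameCycle M (Finset.mem_filter.1 hs).2]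
  have hre : (star (rowCycleProd M σ k)).re = (rowCycleProd M σ k).re := by simp
  have hst : star (rowCycleProd M σ k) =
      (2 : ℝ) • ((rowCycleProd M σ k).re : SplitQuaternion) - rowCycleProd M σ k := by
    rw [← add_star_eq]; abel
  simp only [H, if_neg h, if_neg h']
  rw [hW1 σ h, hW2 σ h, hW1 _ h', hW2 _ h', hx, hy, hP, sign_reverseCycle, hre, hst, sub_mul,
    smul_mul_assoc, QuaternionAlgebra.coe_mul_eq_smul]
  module

end Swap

section Expansion

/-- The permutation of `Fin (n + 1)` that fixes `i` and acts as `σ` on the other elements. -/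
def liftPerm (i : Fin (n + 1)) (σ : Equiv.Perm (Fin n)) : Equiv.Perm (Fin (n + 1)) :=
  σ.extendDomain (finSuccAboveEquiv i)

variable (i : Fin (n + 1)) (σ : Equiv.Perm (Fin n))

lemma liftPerm_succAbove (x : Fin n) : liftPerm i σ (i.succAbove x) = i.succAbove (σ x) :=
  Equiv.Perm.extendDomain_apply_image σ (finSuccAboveEquiv i) x

lemma liftPerm_self : liftPerm i σ i = i :=
  Equiv.Perm.extendDomain_apply_not_subtype σ (finSuccAboveEquiv i) (by simp)

lemma sign_liftPerm : Equiv.Perm.sign (liftPerm i σ) = Equiv.Perm.sign σ :=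
  Equiv.Perm.sign_extendDomain σ (finSuccAboveEquiv i)

lemma bijective_swap_mul_liftPerm :
    Function.Bijective fun p : Fin (n + 1) × Equiv.Perm (Fin n) =>
      Equiv.swap i p.1 * liftPerm i p.2 := by
  refine (Fintype.bijective_iff_injective_and_card _).2 ⟨?_, ?_⟩
  · rintro ⟨j, σ⟩ ⟨j', σ'⟩ h
    have hj : j = j' := by
      have := congrArg (fun τ : Equiv.Perm (Fin (n + 1)) => τ i) h
      simpa [liftPerm_self] using this
    subst hj
    have hσ : liftPerm i σ = liftPerm i σ' := mul_left_cancel h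
    exact Prod.ext rfl (Equiv.Perm.extendDomainHom_injective (finSuccAboveEquiv i) hσ)
  · simp [Fintype.card_perm, Nat.factorial_succ]

variable {i σ}

lemma min_succAbove_iff {τ : Equiv.Perm (Fin (n + 1))} {s : Fin n}
    (h : ∀ y, σ.SameCycle s y → τ (i.succAbove y) = i.succAbove (σ y)) :
    (∀ t, τ.SameCycle (i.succAbove s) t → i.succAbove s ≤ t) ↔
      ∀ y, σ.SameCycle s y → s ≤ y := by
  simp only [sameCycle_iff_of_conj Fin.succAbove_right_injective h]
  constructor
  · intro h' y hy
    exact (Fin.strictMono_succAbove i).le_iff_le.1 (h' _ ⟨y, hy, rfl⟩)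
  · rintro h' _ ⟨y, hy, rfl⟩
    exact (Fin.strictMono_succAbove i).le_iff_le.2 (h' y hy)

lemma otherMins_liftPerm :
    otherMins (liftPerm i σ) i = (cycleMins σ).image i.succAbove := by
  ext t
  rw [mem_otherMins, Finset.mem_image]
  have hi : ∀ t, (liftPerm i σ).SameCycle i t ↔ t = i := fun t =>
    ⟨fun h => (h.eq_of_left (liftPerm_self i σ)).symm, fun h => h ▸ Equiv.Perm.SameCycle.rfl⟩
  rw [hi]
  constructor
  · rintro ⟨h1, h2⟩
    obtain ⟨s, rfl⟩ := Fin.exists_succAbove_eq h2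
    exact ⟨s, mem_cycleMins.2
      ((min_succAbove_iff fun y _ => liftPerm_succAbove i σ y).1 h1), rfl⟩
  · rintro ⟨s, hs, rfl⟩
    exact ⟨(min_succAbove_iff fun y _ => liftPerm_succAbove i σ y).2 (mem_cycleMins.1 hs),
      Fin.succAbove_ne i s⟩

lemma exists_extended_path (i : Fin (n + 1)) (σ : Equiv.Perm (Fin n)) (j : Fin n) :
    ∃ f : ℕ → Fin (n + 1), f 0 = i ∧ f (Function.minimalPeriod σ j + 1) = i ∧
      (∀ m < Function.minimalPeriod σ j, f (m + 1) = i.succAbove ((σ ^ m) j)) ∧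
      (∀ m < Function.minimalPeriod σ j + 1,
        (Equiv.swap i (i.succAbove j) * liftPerm i σ) (f m) = f (m + 1)) ∧
      (∀ m, 0 < m → m < Function.minimalPeriod σ j + 1 → f m ≠ i) := by
  set p := Function.minimalPeriod σ j with hpdef
  have hp : 0 < p := minimalPeriod_perm_pos σ j
  let f : ℕ → Fin (n + 1) := fun m =>
    if m = 0 ∨ m = p + 1 then i else i.succAbove ((σ ^ (m - 1)) j)
  have f1 : ∀ m < p, f (m + 1) = i.succAbove ((σ ^ m) j) := fun m hm => by
    simp [f, hm.ne]
  have f2 : f (p + 1) = i := by simp [f]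
  refine ⟨f, by simp [f], f2, f1, ?_, ?_⟩
  · intro m hm
    rcases Nat.eq_zero_or_pos m with rfl | h0
    · rw [f1 0 hp, Equiv.Perm.mul_apply]
      simp [f, liftPerm_self]
    · obtain ⟨r, rfl⟩ := Nat.exists_eq_succ_of_ne_zero h0.ne'
      rw [Nat.succ_eq_add_one, f1 r (by omega), Equiv.Perm.mul_apply, liftPerm_succAbove,
        ← Equiv.Perm.mul_apply, ← pow_succ']
      rcases Nat.lt_or_ge (r + 1) p with hr | hr
      · rw [f1 _ hr, Equiv.swap_apply_of_ne_of_ne (Fin.succAbove_ne i _)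
          (Fin.succAbove_right_injective.ne
            (pow_apply_ne_of_lt_minimalPeriod σ j (Nat.succ_pos r) hr))]
      · have : r + 1 = p := by omega
        rw [this, f2, hpdef, pow_minimalPeriod_apply, Equiv.swap_apply_right]
  · intro m h0 hm
    obtain ⟨r, rfl⟩ := Nat.exists_eq_succ_of_ne_zero h0.ne'
    rw [Nat.succ_eq_add_one, f1 r (by omega)]
    exact Fin.succAbove_ne i _

lemma sameCycle_swap_mul_liftPerm {j : Fin n} {t : Fin (n + 1)} :
    (Equiv.swap i (i.succAbove j) * liftPerm i σ).SameCycle i t ↔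
      t = i ∨ ∃ y, σ.SameCycle j y ∧ i.succAbove y = t := by
  obtain ⟨f, f0, fl, f1, hstep, hne⟩ := exists_extended_path i σ j
  rw [sameCycle_iff_of_path (Nat.succ_pos _) f0 fl hstep hne]
  simp only [sameCycle_iff_exists_lt]
  constructor
  · rintro ⟨m, hm, rfl⟩
    cases m with
    | zero => exact Or.inl f0
    | succ r => exact Or.inr ⟨_, ⟨r, by omega, rfl⟩, (f1 r (by omega)).symm⟩
  · rintro (rfl | ⟨_, ⟨m, hm, rfl⟩, rfl⟩)
    · exact ⟨0, by omega, f0⟩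
    · exact ⟨m + 1, by omega, f1 m hm⟩

lemma swap_mul_liftPerm_apply {j s : Fin n} (h : ¬ σ.SameCycle j s) (y : Fin n)
    (hy : σ.SameCycle s y) :
    (Equiv.swap i (i.succAbove j) * liftPerm i σ) (i.succAbove y) = i.succAbove (σ y) := by
  rw [Equiv.Perm.mul_apply, liftPerm_succAbove, Equiv.swap_apply_of_ne_of_ne
    (Fin.succAbove_ne i _)]
  refine Fin.succAbove_right_injective.ne ?_
  rintro rfl
  exact h (Equiv.Perm.sameCycle_apply_right.2 hy).symm

lemma otherMins_swap_mul_liftPerm {j : Fin n} :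
    otherMins (Equiv.swap i (i.succAbove j) * liftPerm i σ) i =
      (otherMins σ j).image i.succAbove := by
  ext t
  rw [mem_otherMins, Finset.mem_image, sameCycle_swap_mul_liftPerm]
  constructor
  · rintro ⟨h1, h2⟩
    obtain ⟨s, rfl⟩ := Fin.exists_succAbove_eq fun h => h2 (Or.inl h)
    have hs : ¬ σ.SameCycle j s := fun h => h2 (Or.inr ⟨s, h, rfl⟩)
    exact ⟨s, mem_otherMins.2
      ⟨(min_succAbove_iff (swap_mul_liftPerm_apply hs)).1 h1, hs⟩, rfl⟩
  · rintro ⟨s, hs, rfl⟩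
    rw [mem_otherMins] at hs
    refine ⟨(min_succAbove_iff (swap_mul_liftPerm_apply hs.2)).2 hs.1, ?_⟩
    rintro (h | ⟨y, hy, h⟩)
    · exact Fin.succAbove_ne i s h
    · exact hs.2 (Fin.succAbove_right_injective h ▸ hy)

lemma cofR_self {A : Matrix (Fin (n + 1)) (Fin (n + 1)) SplitQuaternion} (hA : A.IsHermitian) :
    cofR A i i = (realDet (A.submatrix i.succAbove i.succAbove) : SplitQuaternion) := by
  unfold cofR
  rw [dif_pos rfl]
  split_ifs with hn
  · exact rdet_eq_realDet (hA.submatrix _) _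
  · obtain rfl : n = 0 := by omega
    simp [realDet, cycleMins]

lemma cofR_succAbove (A : Matrix (Fin (n + 1)) (Fin (n + 1)) SplitQuaternion) (j : Fin n) :
    cofR A i (i.succAbove j) = -rdet ((A.updateCol (i.succAbove j)
      (fun p => A p i)).submatrix i.succAbove i.succAbove) j := by
  unfold cofR
  rw [dif_neg (Fin.succAbove_ne i j).symm]
  congr 2
  ext
  simp only [Fin.succAbove, Fin.lt_def]
  split_ifs <;> simp_all
  omega

/-- Row expansion of the `i`-th row determinant after replacing the `i`-th row. -/
lemma rdet_updateRow {A : Matrix (Fin (n + 1)) (Fin (n + 1)) SplitQuaternion}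
    (hA : A.IsHermitian) (v : Fin (n + 1) → SplitQuaternion) :
    rdet (A.updateRow i v) i = ∑ j, v j * cofR A i j := by
  have hA' : ∀ p q, A p q = star (A q p) := fun p q => (hA.apply p q).symm
  set M := A.updateRow i v with hMdef
  have hMi : ∀ q, M i q = v q := fun q => by simp [hMdef]
  have hMe : ∀ x q, M (i.succAbove x) q = A (i.succAbove x) q := fun x q => by
    simp [hMdef, Matrix.updateRow_apply, Fin.succAbove_ne]
  rw [rdet_eq_sum_re (M := M) (i := i) fun p q hp hq => by
    simp [hMdef, Matrix.updateRow_apply, hp, hq, hA' p q]]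
  rw [← (bijective_swap_mul_liftPerm i).sum_comp, Fintype.sum_prod_type]
  refine Finset.sum_congr rfl fun j _ => ?_
  by_cases hj : j = i
  · subst hj
    rw [cofR_self hA, realDet, ← QuaternionAlgebra.coe_algebraMap, map_sum, Finset.mul_sum]
    refine Finset.sum_congr rfl fun σ _ => ?_
    rw [QuaternionAlgebra.coe_algebraMap, QuaternionAlgebra.mul_coe_eq_smul]
    simp only [Equiv.swap_self]
    rw [show (Equiv.refl _ : Equiv.Perm (Fin (n + 1))) = 1 from rfl, one_mul, sign_liftPerm,
      otherMins_liftPerm, Finset.prod_image Fin.succAbove_right_injective.injOn]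
    have h1 : rowCycleProd M (liftPerm j σ) j = v j := by
      rw [rowCycleProd_eq_of_path M (f := fun _ => j) one_pos rfl rfl
        (fun _ _ => liftPerm_self j σ) (fun m _ _ => by omega)]
      simp [hMi]
    rw [h1]
    congr 2
    refine Finset.prod_congr rfl fun s _ => congrArg _ ?_
    exact rowCycleProd_eq_of_conj Fin.succAbove_right_injective
      (fun y _ => liftPerm_succAbove j σ y) fun y _ => hMe _ _
  · obtain ⟨j, rfl⟩ := Fin.exists_succAbove_eq hj
    set N := (A.updateCol (i.succAbove j) (fun p => A p i)).submatrix i.succAbove i.succAbove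
      with hNdef
    have hN : ∀ p q, q ≠ j → N p q = A (i.succAbove p) (i.succAbove q) := fun p q hq => by
      simp [hNdef, hq]
    have hNj : ∀ p, N p j = A (i.succAbove p) i := fun p => by simp [hNdef]
    rw [cofR_succAbove, ← hNdef, rdet_eq_sum_re (M := N) (i := j) fun p q hp hq => by
      rw [hN p q hq, hN q p hp, hA'], mul_neg, Finset.mul_sum, ← Finset.sum_neg_distrib]
    refine Finset.sum_congr rfl fun σ _ => ?_
    simp only
    rw [otherMins_swap_mul_liftPerm, Finset.prod_image Fin.succAbove_right_injective.injOn,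
      Equiv.Perm.sign_mul, Equiv.Perm.sign_swap (Fin.succAbove_ne i j).symm, sign_liftPerm]
    have h1 : ∏ s ∈ otherMins σ j, (rowCycleProd M
        (Equiv.swap i (i.succAbove j) * liftPerm i σ) (i.succAbove s)).re =
        ∏ s ∈ otherMins σ j, (rowCycleProd N σ s).re := by
      refine Finset.prod_congr rfl fun s hs => congrArg _ ?_
      have hs' := (mem_otherMins.1 hs).2
      refine rowCycleProd_eq_of_conj Fin.succAbove_right_injective
        (swap_mul_liftPerm_apply hs') fun y hy => ?_
      rw [hMe, hN]
      rintro rfl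
      exact hs' (Equiv.Perm.sameCycle_apply_right.2 hy).symm
    have h2 : rowCycleProd M (Equiv.swap i (i.succAbove j) * liftPerm i σ) i =
        v (i.succAbove j) * rowCycleProd N σ j := by
      obtain ⟨f, f0, fl, f1, hstep, hne⟩ := exists_extended_path i σ j
      have hp := minimalPeriod_perm_pos σ j
      rw [rowCycleProd_eq_of_path M (Nat.succ_pos _) f0 fl hstep hne, List.prod_range_succ', f0,
        f1 0 hp, hMi]
      unfold rowCycleProd
      congr 2
      apply List.map_congr_left
      intro m hm
      rw [List.mem_range] at hm
      simp only [Nat.succ_eq_add_one]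
      rw [f1 m hm, hMe]
      rcases Nat.lt_or_ge (m + 1) (Function.minimalPeriod σ j) with hr | hr
      · rw [f1 _ hr, hN _ _ (pow_apply_ne_of_lt_minimalPeriod σ j (Nat.succ_pos m) hr)]
      · have : m + 1 = Function.minimalPeriod σ j := by omega
        rw [this, fl, pow_minimalPeriod_apply, hNj]
    rw [h1, h2, mul_smul_comm]
    simp

end Expansion

section Inverse

lemma cdet_eq_star_rdet {a : ℕ} (M : Matrix (Fin a) (Fin a) SplitQuaternion) (j : Fin a) :
    cdet M j = star (rdet M.conjTranspose j) := by
  unfold cdet rdet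
  rw [star_sum]
  refine Finset.sum_congr rfl fun σ _ => ?_
  have h : ∀ s, star (rowCycleProd M.conjTranspose σ s) = colCycleProd M σ s := fun s => by
    rw [star_rowCycleProd, Matrix.conjTranspose_conjTranspose]
  rw [star_mul, star_mul, star_list_prod, ← List.map_reverse, List.map_map, h, star_intCast,
    (Int.cast_commute _ _).eq]
  congr 4
  funext s
  exact (h s).symm

lemma cofL_eq_star_cofR {A : Matrix (Fin (n + 1)) (Fin (n + 1)) SplitQuaternion}
    (hA : A.IsHermitian) (i j : Fin (n + 1)) : cofL A i j = star (cofR A j i) := by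
  have hA' : ∀ p q, star (A p q) = A q p := fun p q => hA.apply q p
  unfold cofL cofR
  by_cases hij : i = j
  · subst hij
    rw [dif_pos rfl, dif_pos rfl]
    split_ifs
    · rw [cdet_eq_star_rdet, (hA.submatrix _).eq]
    · simp
  · rw [dif_neg hij, dif_neg (Ne.symm hij), cdet_eq_star_rdet, star_neg]
    congr 3
    ext1 p q
    simp only [Matrix.conjTranspose_apply, Matrix.submatrix_apply, Matrix.updateRow_apply,
      Matrix.updateCol_apply]
    split_ifs <;> simp [hA']

lemma mul_cofR_matrix {A : Matrix (Fin (n + 1)) (Fin (n + 1)) SplitQuaternion}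
    (hA : A.IsHermitian) :
    A * Matrix.of (fun p q => cofR A q p) = realDet A • (1 : Matrix _ _ SplitQuaternion) := by
  have hA' : ∀ p q, A p q = star (A q p) := fun p q => (hA.apply p q).symm
  ext1 k i
  rw [Matrix.mul_apply]
  simp only [Matrix.of_apply]
  rw [← rdet_updateRow hA (A k)]
  by_cases hki : k = i
  · subst hki
    rw [Matrix.updateRow_eq_self, rdet_eq_realDet hA, Matrix.smul_apply, Matrix.one_apply_eq,
      ← QuaternionAlgebra.coe_mul_eq_smul, mul_one]
  · rw [rdet_eq_zero_of_row_eq (k := k) (Ne.symm hki)]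
    · simp [hki]
    · intro p q hp hq
      simp [Matrix.updateRow_apply, hp, hq, hA' p q]
    · funext q
      simp [Matrix.updateRow_apply, hki]

end Inverse

/-- A Hermitian matrix `A` with `det A ≠ 0` has a unique two-sided inverse, which is
`(1/det A)` times the transposed matrix of right cofactors and also `(1/det A)` times
the transposed matrix of left cofactors. -/
theorem exists_unique_inverse_eq_cofactor_matrices
    (A : Matrix (Fin (n + 1)) (Fin (n + 1)) SplitQuaternion) (hA : A.IsHermitian)
    (hd : hdet A ≠ 0) :
    (∃! B : Matrix (Fin (n + 1)) (Fin (n + 1)) SplitQuaternion,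
      A * B = 1 ∧ B * A = 1) ∧
    (∀ B : Matrix (Fin (n + 1)) (Fin (n + 1)) SplitQuaternion,
      A * B = 1 ∧ B * A = 1 →
        B = ((hdet A).re)⁻¹ • Matrix.of (fun p q => cofR A q p) ∧
        B = ((hdet A).re)⁻¹ • Matrix.of (fun p q => cofL A q p)) := by
  have hdr : hdet A = (realDet A : SplitQuaternion) := rdet_eq_realDet hA 0
  have hre : (hdet A).re = realDet A := by rw [hdr, QuaternionAlgebra.re_coe]
  have hne : realDet A ≠ 0 := fun h => hd (by rw [hdr, h, QuaternionAlgebra.coe_zero])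
  rw [hre]
  set R := (realDet A)⁻¹ • Matrix.of (fun p q => cofR A q p) with hR
  set L := (realDet A)⁻¹ • Matrix.of (fun p q => cofL A q p) with hL
  have hAR : A * R = 1 := by
    rw [hR, Matrix.mul_smul, mul_cofR_matrix hA, smul_smul, inv_mul_cancel₀ hne, one_smul]
  have hLR : L = R.conjTranspose := by
    ext1 p q
    simp only [hL, hR, Matrix.smul_apply, Matrix.of_apply, Matrix.conjTranspose_apply,
      cofL_eq_star_cofR hA]
    rw [QuaternionAlgebra.star_smul']
  have hLA : L * A = 1 := by
    rw [hLR, ← congrArg (R.conjTranspose * ·) hA.eq, ← Matrix.conjTranspose_mul, hAR,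
      Matrix.conjTranspose_one]
  have hLeqR : L = R := left_inv_eq_right_inv hLA hAR
  have huniq : ∀ B, A * B = 1 ∧ B * A = 1 → B = R := fun B hB =>
    left_inv_eq_right_inv hB.2 hAR
  exact ⟨⟨R, ⟨hAR, hLeqR ▸ hLA⟩, huniq⟩, fun B hB => ⟨huniq B hB, (huniq B hB).trans hLeqR.symm⟩⟩

end SplitQuaternion

end
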